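/- Let H ∈ (1/2,1), c > 0 and s < t be real numbers. Let B be a finite set with |B| > 2, let Δ be a partition of B with no singleton blocks, and let p be a pairing of B such that (Δ,p) is connected. Then there exists a constant C (depending on H, c, s, t, B, Δ, p but not on ε) such that for all ε ∈ (0,1]: J̃^ε(Δ,p) ≤ C ε^{2−2H}. -/

import Mathlib

open MeasureTheory Finset

variable {α : Type*} [DecidableEq α]

/-- `Δ` is a partition of the finite set `B`. -/
def IsPartitionOf (B : Finset α) (Δ : Finset (Finset α)) : Prop :=
  (∀ b ∈ Δ, b.Nonempty) ∧ Δ.sup id = B ∧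
    ∀ b ∈ Δ, ∀ c ∈ Δ, b ≠ c → Disjoint b c

/-- The pair of partitions `(Δ, p)` of `B` is connected, i.e. `Δ ∨ p = {B}`. -/
def ConnectedPair (B : Finset α) (Δ p : Finset (Finset α)) : Prop :=
  ∀ S ⊆ B, (∀ b ∈ Δ, b ⊆ S ∨ Disjoint b S) → (∀ b ∈ p, b ⊆ S ∨ Disjoint b S) →
    S = ∅ ∨ S = B

/-- Extend a function indexed by the subtype `↥B` to all of `α` by zero. -/
noncomputable def extendBy (B : Finset α) (r : {x // x ∈ B} → ℝ) (a : α) : ℝ :=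
  if h : a ∈ B then r ⟨a, h⟩ else 0

/-- For a two-element set `q = {a, b}`, this is `|r a - r b|`. -/
noncomputable def pairGap (r : α → ℝ) (q : Finset α) : ℝ :=
  if h : q.Nonempty then q.sup' h r - q.inf' h r else 0

/-- The cumulant integral
`J̃^ε(Δ,p) = ε^{σ(Δ)(H−1/2)+|B|/2} ∫_{[s/ε,t/ε]^B} ∏_{A ∈ Δ, |A|≥2} e^{−c Σ_{i,j∈A}|r_i−r_j|}
  ∏_{{a,b}∈p} |r_a−r_b|^{2H−2} dr^B`,
where `σ(Δ)` is the number of singleton blocks of `Δ`. -/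
noncomputable def Jtilde (H c s t ε : ℝ) (B : Finset α) (Δ p : Finset (Finset α)) : ℝ :=
  ε ^ ((((Δ.filter fun A => A.card = 1).card : ℝ)) * (H - 1 / 2) + (B.card : ℝ) / 2) *
    ∫ r : {x // x ∈ B} → ℝ in Set.univ.pi fun _ => Set.Icc (s / ε) (t / ε),
      (∏ A ∈ Δ.filter fun A => 2 ≤ A.card,
        Real.exp (-c * ∑ i ∈ A, ∑ j ∈ A, |extendBy B r i - extendBy B r j|)) *
      ∏ q ∈ p, pairGap (extendBy B r) q ^ (2 * H - 2)


lemma IsPartitionOf.disjoint_sup {B : Finset α} {P Q : Finset (Finset α)} {D : Finset α}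
    (hP : IsPartitionOf B P) (hQ : Q ⊆ P) (hD : D ∈ P) (hDQ : D ∉ Q) :
    Disjoint (Q.sup id) D := by
  rw [Finset.disjoint_sup_left]
  intro A hA
  exact hP.2.2 A (hQ hA) D hD fun h => hDQ (h ▸ hA)

lemma IsPartitionOf.subset {B : Finset α} {P : Finset (Finset α)} {D : Finset α}
    (hP : IsPartitionOf B P) (hD : D ∈ P) : D ⊆ B := by
  rw [← hP.2.1]
  exact Finset.le_sup (f := id) hD

lemma IsPartitionOf.sum_card {B : Finset α} {P : Finset (Finset α)} (hP : IsPartitionOf B P) :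
    ∑ D ∈ P, D.card = B.card := by
  rw [← hP.2.1, Finset.sup_eq_biUnion, Finset.card_biUnion]
  · rfl
  · exact fun D hD A hA h => hP.2.2 D hD A hA h

/-- In a connected pair, a proper nonempty subfamily of the parts is linked to another part. -/
lemma ConnectedPair.exists_link {B : Finset α} {P E Q : Finset (Finset α)}
    (hP : IsPartitionOf B P) (hE : ∀ A ∈ E, A ⊆ B) (hc : ConnectedPair B P E)
    (hQ : Q ⊆ P) (hne : Q.Nonempty) (hQP : Q ≠ P) :
    ∃ A ∈ E, ∃ a ∈ A, ∃ b ∈ A, ∃ D ∈ P, D ∉ Q ∧ a ∈ Q.sup id ∧ b ∈ D := by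
  by_contra! hcon
  have hsub : Q.sup id ⊆ B := by
    rw [← hP.2.1]
    exact Finset.sup_mono hQ
  have h1 : ∀ D ∈ P, D ⊆ Q.sup id ∨ Disjoint D (Q.sup id) := by
    intro D hD
    by_cases hDQ : D ∈ Q
    · exact Or.inl (Finset.le_sup (f := id) hDQ)
    · exact Or.inr (hP.disjoint_sup hQ hD hDQ).symm
  have h2 : ∀ A ∈ E, A ⊆ Q.sup id ∨ Disjoint A (Q.sup id) := by
    intro A hA
    by_contra! hA'
    obtain ⟨a, haA, ha⟩ := Finset.not_disjoint_iff.1 hA'.2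
    obtain ⟨b, hbA, hb⟩ := Finset.not_subset.1 hA'.1
    have hbB := hE A hA hbA
    rw [← hP.2.1] at hbB
    obtain ⟨D, hD, hbD⟩ := Finset.mem_sup.1 hbB
    exact hcon A hA a haA b hbA D hD (fun h => hb (Finset.mem_sup.2 ⟨D, h, hbD⟩)) ha hbD
  rcases hc (Q.sup id) hsub h1 h2 with h | h
  · obtain ⟨D, hD⟩ := hne
    obtain ⟨x, hx⟩ := hP.1 D (hQ hD)
    have : x ∈ Q.sup id := Finset.mem_sup.2 ⟨D, hD, hx⟩
    simp [h] at this
  · obtain ⟨D, hD, hDQ⟩ := Finset.exists_of_ssubset (hQ.ssubset_of_ne hQP)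
    have hdis := hP.disjoint_sup hQ hD hDQ
    rw [h] at hdis
    obtain ⟨x, hx⟩ := hP.1 D hD
    exact Finset.disjoint_left.1 hdis (hP.subset hD hx) hx

lemma exists_linking_subfamily_aux {B : Finset α} {P E : Finset (Finset α)}
    (hP : IsPartitionOf B P) (hE : ∀ A ∈ E, A ⊆ B) (hc : ConnectedPair B P E) (k : ℕ)
    (hk : k + 1 ≤ P.card) :
    ∃ Q ⊆ P, Q.card = k + 1 ∧ ∃ F ⊆ E, F.card ≤ k ∧
      ∀ S : Finset α, (∀ b ∈ P, b ⊆ S ∨ Disjoint b S) → (∀ b ∈ F, b ⊆ S ∨ Disjoint b S) →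
        Q.sup id ⊆ S ∨ Disjoint (Q.sup id) S := by
  induction k with
  | zero =>
    obtain ⟨D, hD⟩ := Finset.card_pos.1 (by omega : 0 < P.card)
    refine ⟨{D}, by simpa using hD, by simp, ∅, by simp, by simp, fun S hS _ => ?_⟩
    simpa using hS D hD
  | succ k ih =>
    obtain ⟨Q, hQ, hQk, F, hF, hFk, hS⟩ := ih (by omega)
    obtain ⟨A, hA, a, haA, b, hbA, D, hD, hDQ, ha, hb⟩ :=
      hc.exists_link hP hE hQ (Finset.card_pos.1 (by omega)) (by rintro rfl; omega)
    refine ⟨insert D Q, Finset.insert_subset hD hQ, by rw [Finset.card_insert_of_notMem hDQ, hQk],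
      insert A F, Finset.insert_subset hA hF, (Finset.card_insert_le _ _).trans (by omega),
      fun S hPS hFS => ?_⟩
    have h1 := hS S hPS fun b hb => hFS b (Finset.mem_insert_of_mem hb)
    have h2 := hPS D hD
    have h3 := hFS A (Finset.mem_insert_self _ _)
    rw [Finset.sup_insert, id, Finset.sup_eq_union, Finset.union_subset_iff,
      Finset.disjoint_union_left]
    simp only [Finset.disjoint_left] at h1 h2 h3 ⊢
    rcases h3 with h3 | h3
    · have e1 := h1.resolve_right fun h => h ha (h3 haA)
      have e2 := h2.resolve_right fun h => h hb (h3 hbA)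
      exact Or.inl ⟨e2, e1⟩
    · have e1 := h1.resolve_left fun h => h3 haA (h ha)
      have e2 := h2.resolve_left fun h => h3 hbA (h hb)
      exact Or.inr ⟨e2, e1⟩

/-- A connected pair stays connected after thinning out the linking family to fewer members than
there are parts. -/
lemma ConnectedPair.exists_small_subfamily {B : Finset α} {P E : Finset (Finset α)}
    (hP : IsPartitionOf B P) (hE : ∀ A ∈ E, A ⊆ B) (hc : ConnectedPair B P E)
    (hne : P.Nonempty) :
    ∃ F ⊆ E, F.card + 1 ≤ P.card ∧ ConnectedPair B P F := by
  have hpos := Finset.card_pos.2 hne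
  obtain ⟨Q, hQ, hQk, F, hF, hFk, hS⟩ :=
    exists_linking_subfamily_aux hP hE hc (P.card - 1) (by omega)
  obtain rfl : Q = P := Finset.eq_of_subset_of_card_le hQ (by omega)
  refine ⟨F, hF, by omega, fun S hSB hPS hFS => ?_⟩
  have h := hS S hPS hFS
  rw [hP.2.1] at h
  rcases h with h | h
  · exact Or.inr (hSB.antisymm h)
  · exact Or.inl (Finset.disjoint_self_iff_empty _ |>.1 (h.mono_left hSB))

lemma lmarginal_const_mul_of_dependsOn (ν : Measure ℝ) {U s : Finset α}
    {f g : (α → ℝ) → ENNReal} (hf : Measurable f) (hg : DependsOn g (U : Set α))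
    (hUs : Disjoint U s) (x : α → ℝ) :
    (lmarginal (fun _ : α => ν) s fun x => g x * f x) x =
      g x * lmarginal (fun _ : α => ν) s f x := by
  simp only [lmarginal]
  have hm : Measurable fun y : s → ℝ => f (Function.updateFinset x s y) :=
    hf.comp measurable_updateFinset
  rw [← lintegral_const_mul (g x) hm]
  refine lintegral_congr fun y => ?_
  congr 1
  refine hg fun i hi => ?_
  have : i ∉ s := Finset.disjoint_left.1 hUs hi
  simp [Function.updateFinset, this]

/-- Growing a connected cluster of parts one part at a time, each step costing a factor `M`. -/
lemma lmarginal_cluster_le_aux (ν : Measure ℝ) [SigmaFinite ν] {B : Finset α}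
    {P E : Finset (Finset α)} (hP : IsPartitionOf B P) (hE : ∀ A ∈ E, A ⊆ B)
    (hc : ConnectedPair B P E) {f : Finset α → (α → ℝ) → ENNReal}
    (hf : ∀ D ∈ P, Measurable (f D)) (hfD : ∀ D ∈ P, DependsOn (f D) (D : Set α))
    {ψ : (α → ℝ) → ENNReal} {h : ℝ → ENNReal} (hh : Measurable h)
    (hψ : ∀ A ∈ E, ∀ a ∈ A, ∀ b ∈ A, ∀ x, ψ x ≤ h (x a - x b))
    {L M : ENNReal} {K : Finset α → ENNReal}
    (hinit : ∀ D ∈ P, ∀ x, lmarginal (fun _ => ν) D (f D) x ≤ L * K D)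
    (hatt : ∀ D ∈ P, ∀ b ∈ D, ∀ a ∉ D, ∀ x,
      (lmarginal (fun _ => ν) D fun x => f D x * h (x a - x b)) x ≤ M * K D)
    (k : ℕ) (hk : k + 1 ≤ P.card) :
    ∃ Q ⊆ P, Q.card = k + 1 ∧ ∃ g : (α → ℝ) → ENNReal, Measurable g ∧
      DependsOn g ((Q.sup id : Finset α) : Set α) ∧
      (∀ x, ψ x ^ k * ∏ D ∈ Q, f D x ≤ g x) ∧
      ∀ x, lmarginal (fun _ => ν) (Q.sup id) g x ≤ L * M ^ k * ∏ D ∈ Q, K D := by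
  induction k with
  | zero =>
    obtain ⟨D, hD⟩ := Finset.card_pos.1 (by omega : 0 < P.card)
    refine ⟨{D}, by simpa using hD, by simp, f D, hf D hD, ?_, ?_, ?_⟩
    · simpa using hfD D hD
    · simp
    · simpa using hinit D hD
  | succ k ih =>
    obtain ⟨Q, hQ, hQk, g, hg, hgQ, hle, hint⟩ := ih (by omega)
    obtain ⟨A, hA, a, haA, b, hbA, D, hD, hDQ, ha, hb⟩ :=
      hc.exists_link hP hE hQ (Finset.card_pos.1 (by omega)) (by rintro rfl; omega)
    have hdis := hP.disjoint_sup hQ hD hDQ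
    have haD : a ∉ D := Finset.disjoint_left.1 hdis ha
    have hmeas : Measurable fun x : α → ℝ => f D x * h (x a - x b) :=
      (hf D hD).mul (hh.comp ((measurable_pi_apply a).sub (measurable_pi_apply b)))
    have hsup : (insert D Q).sup id = Q.sup id ∪ D := by
      rw [Finset.sup_insert, id, Finset.sup_eq_union, Finset.union_comm]
    refine ⟨insert D Q, Finset.insert_subset hD hQ, by rw [Finset.card_insert_of_notMem hDQ, hQk],
      fun x => g x * (f D x * h (x a - x b)), hg.mul hmeas, ?_, fun x => ?_, fun x => ?_⟩
    · rw [hsup]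
      intro x y hxy
      have e1 : g x = g y := hgQ fun i hi => hxy i (by
        rw [Finset.coe_union]; exact Or.inl hi)
      have e2 : f D x = f D y := hfD D hD fun i hi => hxy i (by
        rw [Finset.coe_union]; exact Or.inr hi)
      have e3 : x a = y a := hxy a (Finset.mem_coe.2 (Finset.mem_union_left _ ha))
      have e4 : x b = y b := hxy b (Finset.mem_coe.2 (Finset.mem_union_right _ hb))
      simp only [e1, e2, e3, e4]
    · rw [Finset.prod_insert hDQ, pow_succ]
      calc ψ x ^ k * ψ x * (f D x * ∏ D ∈ Q, f D x)
          = (ψ x ^ k * ∏ D ∈ Q, f D x) * (f D x * ψ x) := by ring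
        _ ≤ _ := mul_le_mul' (hle x) (mul_le_mul' le_rfl (hψ A hA a haA b hbA x))
    · have hm : Measurable fun x : α → ℝ => g x * (f D x * h (x a - x b)) := hg.mul hmeas
      rw [hsup, lmarginal_union _ _ hm hdis, Finset.prod_insert hDQ]
      have h1 : (lmarginal (fun _ => ν) D fun x => g x * (f D x * h (x a - x b))) ≤
          fun x => M * K D * g x := by
        intro x
        rw [lmarginal_const_mul_of_dependsOn ν hmeas hgQ hdis, mul_comm]
        exact mul_le_mul' (hatt D hD b hb a haD x) le_rfl
      refine (lmarginal_mono h1 x).trans ?_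
      have h2 : (lmarginal (fun _ : α => ν) (Q.sup id) fun x => M * K D * g x) x =
          M * K D * lmarginal (fun _ => ν) (Q.sup id) g x :=
        lmarginal_const_mul_of_dependsOn ν (U := ∅) hg (fun _ _ _ => rfl) (by simp) x
      rw [h2]
      calc M * K D * lmarginal (fun _ => ν) (Q.sup id) g x
          ≤ M * K D * (L * M ^ k * ∏ D ∈ Q, K D) := mul_le_mul' le_rfl (hint x)
        _ = _ := by ring

lemma lmarginal_cluster_le (ν : Measure ℝ) [SigmaFinite ν] {B : Finset α}
    {P E : Finset (Finset α)} (hP : IsPartitionOf B P) (hE : ∀ A ∈ E, A ⊆ B)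
    (hc : ConnectedPair B P E) (hne : P.Nonempty) {f : Finset α → (α → ℝ) → ENNReal}
    (hf : ∀ D ∈ P, Measurable (f D)) (hfD : ∀ D ∈ P, DependsOn (f D) (D : Set α))
    {ψ : (α → ℝ) → ENNReal} {h : ℝ → ENNReal} (hh : Measurable h)
    (hψ : ∀ A ∈ E, ∀ a ∈ A, ∀ b ∈ A, ∀ x, ψ x ≤ h (x a - x b))
    {L M : ENNReal} {K : Finset α → ENNReal}
    (hinit : ∀ D ∈ P, ∀ x, lmarginal (fun _ => ν) D (f D) x ≤ L * K D)
    (hatt : ∀ D ∈ P, ∀ b ∈ D, ∀ a ∉ D, ∀ x,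
      (lmarginal (fun _ => ν) D fun x => f D x * h (x a - x b)) x ≤ M * K D) (x : α → ℝ) :
    (lmarginal (fun _ => ν) B fun x => ψ x ^ (P.card - 1) * ∏ D ∈ P, f D x) x ≤
      L * M ^ (P.card - 1) * ∏ D ∈ P, K D := by
  have hpos := Finset.card_pos.2 hne
  obtain ⟨Q, hQ, hQk, g, -, -, hle, hint⟩ :=
    lmarginal_cluster_le_aux ν hP hE hc hf hfD hh hψ hinit hatt (P.card - 1) (by omega)
  obtain rfl : Q = P := Finset.eq_of_subset_of_card_le hQ (by omega)
  rw [hP.2.1] at hint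
  exact (lmarginal_mono hle x).trans (hint x)

lemma lmarginal_pair (ν : Measure ℝ) [SigmaFinite ν] {b b' : α} (hb : b ≠ b')
    {f : (α → ℝ) → ENNReal} (hf : Measurable f) (x : α → ℝ) :
    lmarginal (fun _ => ν) {b, b'} f x =
      ∫⁻ u, ∫⁻ v, f (Function.update (Function.update x b u) b' v) ∂ν ∂ν := by
  rw [lmarginal_insert _ hf (by simpa using hb)]
  simp only [lmarginal_singleton]

lemma lmarginal_pair_kernel_le (ν : Measure ℝ) [SigmaFinite ν] {b b' : α} (hb : b ≠ b')
    {κ h : ℝ → ENNReal} (hκ : Measurable κ) (hh : Measurable h) {K M : ENNReal}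
    (hK : ∀ u, ∫⁻ v, κ |u - v| ∂ν ≤ K) {a : α} (ha : a ≠ b') (ha' : a ≠ b)
    (hM : ∀ u, ∫⁻ v, h (u - v) ∂ν ≤ M) (x : α → ℝ) :
    (lmarginal (fun _ => ν) {b, b'} fun x => κ |x b - x b'| * h (x a - x b)) x ≤ M * K := by
  rw [lmarginal_pair ν hb (by fun_prop)]
  simp only [Function.update_self, Function.update_of_ne hb, Function.update_of_ne ha,
    Function.update_of_ne ha']
  calc ∫⁻ u, ∫⁻ v, κ |u - v| * h (x a - u) ∂ν ∂ν
      = ∫⁻ u, (∫⁻ v, κ |u - v| ∂ν) * h (x a - u) ∂ν := by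
        refine lintegral_congr fun u => ?_
        rw [lintegral_mul_const _ (by fun_prop)]
    _ ≤ ∫⁻ u, K * h (x a - u) ∂ν := lintegral_mono fun u => mul_le_mul' (hK u) le_rfl
    _ = K * ∫⁻ u, h (x a - u) ∂ν := lintegral_const_mul _ (by fun_prop)
    _ ≤ M * K := by rw [mul_comm]; exact mul_le_mul' (hM _) le_rfl

lemma pairGap_pair (x : α → ℝ) (a b : α) : pairGap x {a, b} = |x a - x b| := by
  have h : ({a, b} : Finset α).Nonempty := by simp
  rw [pairGap, dif_pos h]
  have e1 : ({a, b} : Finset α).sup' h x = x a ⊔ x b := by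
    apply le_antisymm
    · exact Finset.sup'_le _ _ (by simp)
    · exact sup_le (Finset.le_sup' x (by simp)) (Finset.le_sup' x (by simp))
  have e2 : ({a, b} : Finset α).inf' h x = x a ⊓ x b := by
    apply le_antisymm
    · exact le_inf (Finset.inf'_le x (by simp)) (Finset.inf'_le x (by simp))
    · exact Finset.le_inf' _ _ (by simp)
  rw [e1, e2, max_sub_min_eq_abs']

lemma pairGap_nonneg (x : α → ℝ) {q : Finset α} (hq : q.card = 2) : 0 ≤ pairGap x q := by
  obtain ⟨a, b, -, rfl⟩ := Finset.card_eq_two.1 hq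
  rw [pairGap_pair]
  exact abs_nonneg _

lemma measurable_pairGap {q : Finset α} (hq : q.card = 2) :
    Measurable fun x : α → ℝ => pairGap x q := by
  obtain ⟨a, b, -, rfl⟩ := Finset.card_eq_two.1 hq
  simp only [pairGap_pair]
  fun_prop

lemma dependsOn_pairGap {q : Finset α} (hq : q.card = 2) :
    DependsOn (fun x : α → ℝ => pairGap x q) (q : Set α) := by
  obtain ⟨a, b, -, rfl⟩ := Finset.card_eq_two.1 hq
  intro x y hxy
  simp only [pairGap_pair, hxy a (by simp), hxy b (by simp)]

/-- Integral bound for a connected pair whose first partition consists of singletons (carrying the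
trivial weight) and of pairs (carrying the weights `κ D (pairGap x D)`). -/
lemma lmarginal_pairs_le (ν : Measure ℝ) [SigmaFinite ν] {B : Finset α}
    {P E W : Finset (Finset α)} (hP : IsPartitionOf B P) (hE : ∀ A ∈ E, A ⊆ B)
    (hc : ConnectedPair B P E) (hne : P.Nonempty) (hWP : W ⊆ P)
    (hW : ∀ D ∈ W, D.card = 2) (hPW : ∀ D ∈ P, D ∉ W → D.card = 1)
    {κ : Finset α → ℝ → ENNReal} (hκ : ∀ D, Measurable (κ D))
    {ψ : (α → ℝ) → ENNReal} {h : ℝ → ENNReal} (hh : Measurable h)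
    (hψ : ∀ A ∈ E, ∀ a ∈ A, ∀ b ∈ A, ∀ x, ψ x ≤ h (x a - x b))
    {M : ENNReal} {K : Finset α → ENNReal}
    (hK : ∀ D, ∀ u, ∫⁻ v, κ D |u - v| ∂ν ≤ K D)
    (hM : ∀ u, ∫⁻ v, h (u - v) ∂ν ≤ M) (x : α → ℝ) :
    (lmarginal (fun _ => ν) B fun x => ψ x ^ (P.card - 1) * ∏ D ∈ W, κ D (pairGap x D)) x ≤
      ν Set.univ * M ^ (P.card - 1) * ∏ D ∈ W, K D := by
  have key := lmarginal_cluster_le ν hP hE hc hne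
    (f := fun D x => if D ∈ W then κ D (pairGap x D) else 1) (ψ := ψ) (h := h)
    (L := ν Set.univ) (M := M) (K := fun D => if D ∈ W then K D else 1) ?_ ?_ hh hψ ?_ ?_ x
  · rw [Finset.prod_ite_mem, Finset.inter_eq_right.2 hWP] at key
    simp only [Finset.prod_ite_mem, Finset.inter_eq_right.2 hWP] at key
    exact key
  · intro D hD
    by_cases hDW : D ∈ W
    · simp only [hDW, if_true]
      exact (hκ D).comp (measurable_pairGap (hW D hDW))
    · simp only [hDW, if_false]
      fun_prop
  · intro D hD x y hxy
    by_cases hDW : D ∈ W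
    · have e : pairGap x D = pairGap y D := dependsOn_pairGap (hW D hDW) hxy
      simp only [hDW, if_true, e]
    · simp only [hDW, if_false]
  · intro D hD x
    by_cases hDW : D ∈ W
    · obtain ⟨b, b', hb, rfl⟩ := Finset.card_eq_two.1 (hW D hDW)
      simp only [hDW, if_true, pairGap_pair]
      have hκ' := hκ {b, b'}
      rw [lmarginal_pair ν hb (by fun_prop)]
      simp only [Function.update_self, Function.update_of_ne hb]
      calc _ ≤ ∫⁻ _, K {b, b'} ∂ν := lintegral_mono fun u => hK _ u
        _ = _ := by rw [lintegral_const, mul_comm]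
    · obtain ⟨b, rfl⟩ := Finset.card_eq_one.1 (hPW D hD hDW)
      simp [hDW, lmarginal_singleton]
  · intro D hD b hbD a haD x
    by_cases hDW : D ∈ W
    · obtain ⟨c, c', hcc, rfl⟩ := Finset.card_eq_two.1 (hW D hDW)
      simp only [hDW, if_true, pairGap_pair]
      simp only [Finset.mem_insert, Finset.mem_singleton, not_or] at haD hbD
      rcases hbD with rfl | rfl
      · exact lmarginal_pair_kernel_le ν hcc (hκ _) hh (hK _) haD.2 haD.1 hM x
      · have := lmarginal_pair_kernel_le ν hcc.symm (hκ {c, b}) hh (hK _) haD.1 haD.2 hM x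
        rw [Finset.pair_comm b c] at this
        convert this using 5
        exact abs_sub_comm _ _
    · obtain ⟨c, rfl⟩ := Finset.card_eq_one.1 (hPW D hD hDW)
      simp only [Finset.mem_singleton] at haD hbD
      subst hbD
      simp only [hDW, if_false, lmarginal_singleton, Function.update_self,
        Function.update_of_ne haD, one_mul, mul_one]
      exact hM _

/-- The kernel `|u|^β`, cut off at distance `R`. -/
noncomputable def truncKernel (β R u : ℝ) : ENNReal :=
  if |u| ≤ R then ENNReal.ofReal (|u| ^ β) else 0

lemma measurable_truncKernel (β R : ℝ) : Measurable (truncKernel β R) :=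
  Measurable.ite (measurableSet_le (by fun_prop) (by fun_prop)) (by fun_prop) measurable_const

lemma lintegral_truncKernel_le {β R : ℝ} (hβ : -1 < β) (hβ' : β ≠ 0) (hR : 0 ≤ R) :
    ∫⁻ u, truncKernel β R u ≤ ENNReal.ofReal (2 / (β + 1) * R ^ (β + 1)) := by
  set g : ℝ → ENNReal := (Set.Ioc 0 R).indicator fun u => ENNReal.ofReal (u ^ β) with hg_def
  have hg : Measurable g := Measurable.indicator (by fun_prop) measurableSet_Ioc
  have hle : ∀ u, truncKernel β R u ≤ g u + g (-u) := by
    intro u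
    unfold truncKernel
    split_ifs with hu
    · rcases lt_trichotomy u 0 with h | rfl | h
      · rw [abs_of_neg h] at hu ⊢
        have : -u ∈ Set.Ioc 0 R := ⟨by linarith, hu⟩
        simp [hg_def, Set.indicator_of_mem this]
      · simp [Real.zero_rpow hβ']
      · rw [abs_of_pos h] at hu ⊢
        have : u ∈ Set.Ioc 0 R := ⟨h, hu⟩
        simp [hg_def, Set.indicator_of_mem this]
    · exact zero_le
  have hint : ∫⁻ u, g u = ENNReal.ofReal (R ^ (β + 1) / (β + 1)) := by
    rw [hg_def, lintegral_indicator measurableSet_Ioc,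
      ← ofReal_integral_eq_lintegral_ofReal
        ((intervalIntegrable_iff_integrableOn_Ioc_of_le hR).1
          (intervalIntegral.intervalIntegrable_rpow' hβ)),
      ← intervalIntegral.integral_of_le hR, integral_rpow (Or.inl hβ),
      Real.zero_rpow (by linarith), sub_zero]
    filter_upwards [ae_restrict_mem measurableSet_Ioc] with u hu
    exact Real.rpow_nonneg hu.1.le _
  have hneg : ∫⁻ u, g (-u) = ∫⁻ u, g u := lintegral_neg_eq_self g
  calc ∫⁻ u, truncKernel β R u ≤ ∫⁻ u, (g u + g (-u)) := lintegral_mono hle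
    _ = _ := by
      have hβ1 : 0 < β + 1 := by linarith
      rw [lintegral_add_left hg, hneg, hint, ← ENNReal.ofReal_add (by positivity) (by positivity)]
      congr 1
      ring

lemma ofReal_rpow_le_add_truncKernel {β R : ℝ} (hβ : β ≤ 0) (hR : 0 < R) (u : ℝ) :
    ENNReal.ofReal (|u| ^ β) ≤ ENNReal.ofReal (R ^ β) + truncKernel β R u := by
  unfold truncKernel
  split_ifs with h
  · exact le_add_self
  · rw [add_zero]
    exact ENNReal.ofReal_le_ofReal (Real.rpow_le_rpow_of_nonpos hR (not_le.1 h).le hβ)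

lemma lintegral_truncKernel_sub_le {β R : ℝ} (hβ : -1 < β) (hβ' : β ≠ 0) (hR : 0 ≤ R)
    (ν : Measure ℝ) (hν : ν ≤ volume) (u : ℝ) :
    ∫⁻ v, truncKernel β R (u - v) ∂ν ≤ ENNReal.ofReal (2 / (β + 1) * R ^ (β + 1)) :=
  (lintegral_mono' hν le_rfl).trans <| by
    rw [lintegral_sub_left_eq_self (truncKernel β R) u]
    exact lintegral_truncKernel_le hβ hβ' hR

lemma lintegral_rpow_abs_sub_le {β S T : ℝ} (hβ : -1 < β) (hβ' : β < 0) (hST : S < T) (u : ℝ) :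
    ∫⁻ v in Set.Icc S T, ENNReal.ofReal (|u - v| ^ β) ≤
      ENNReal.ofReal (1 + 2 / (β + 1)) * ENNReal.ofReal ((T - S) ^ (β + 1)) := by
  have hL : 0 < T - S := sub_pos.2 hST
  have hβ1 : 0 < β + 1 := by linarith
  calc ∫⁻ v in Set.Icc S T, ENNReal.ofReal (|u - v| ^ β)
      ≤ ∫⁻ v in Set.Icc S T, (ENNReal.ofReal ((T - S) ^ β) + truncKernel β (T - S) (u - v)) :=
        lintegral_mono fun v => ofReal_rpow_le_add_truncKernel hβ'.le hL _
    _ = ENNReal.ofReal ((T - S) ^ β) * ENNReal.ofReal (T - S) +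
          ∫⁻ v in Set.Icc S T, truncKernel β (T - S) (u - v) := by
        rw [lintegral_add_left measurable_const, lintegral_const, Measure.restrict_apply_univ,
          Real.volume_Icc]
    _ ≤ ENNReal.ofReal ((T - S) ^ β) * ENNReal.ofReal (T - S) +
          ENNReal.ofReal (2 / (β + 1) * (T - S) ^ (β + 1)) :=
        add_le_add le_rfl
          (lintegral_truncKernel_sub_le hβ hβ'.ne hL.le _ Measure.restrict_le_self u)
    _ = _ := by
        rw [← ENNReal.ofReal_mul (by positivity), ← ENNReal.ofReal_mul (by positivity),
          ← ENNReal.ofReal_add (by positivity) (by positivity), Real.rpow_add hL, Real.rpow_one]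
        congr 1
        ring

lemma lintegral_exp_neg_mul_abs_ne_top {c : ℝ} (hc : 0 < c) :
    ∫⁻ u : ℝ, ENNReal.ofReal (Real.exp (-c * |u|)) ≠ ⊤ := by
  have h : Integrable fun u : ℝ => Real.exp (-c * |u|) := by
    rw [← integrableOn_univ, ← Set.Iic_union_Ioi (a := (0 : ℝ))]
    refine IntegrableOn.union
      ((integrableOn_exp_mul_Iic hc 0).congr_fun (fun u hu => ?_) measurableSet_Iic)
      ((exp_neg_integrableOn_Ioi 0 hc).congr_fun (fun u hu => ?_) measurableSet_Ioi)
    · simp only [abs_of_nonpos (Set.mem_Iic.1 hu), neg_mul_neg]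
    · simp only [abs_of_pos (Set.mem_Ioi.1 hu)]
  exact h.lintegral_lt_top.ne

/-- The total mutual distance inside the blocks of `Δ`. -/
noncomputable def spread {ι : Type*} (Δ : Finset (Finset ι)) (x : ι → ℝ) : ℝ :=
  ∑ A ∈ Δ, ∑ i ∈ A, ∑ j ∈ A, |x i - x j|

lemma spread_nonneg {ι : Type*} (Δ : Finset (Finset ι)) (x : ι → ℝ) : 0 ≤ spread Δ x :=
  Finset.sum_nonneg fun _ _ => Finset.sum_nonneg fun _ _ => Finset.sum_nonneg fun _ _ =>
    abs_nonneg _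

lemma abs_sub_le_spread {ι : Type*} {Δ : Finset (Finset ι)} {A : Finset ι} (hA : A ∈ Δ) {a b : ι}
    (ha : a ∈ A) (hb : b ∈ A) (x : ι → ℝ) : |x a - x b| ≤ spread Δ x := by
  calc |x a - x b| ≤ ∑ j ∈ A, |x a - x j| :=
        Finset.single_le_sum (f := fun j => |x a - x j|) (fun _ _ => abs_nonneg _) hb
    _ ≤ ∑ i ∈ A, ∑ j ∈ A, |x i - x j| :=
        Finset.single_le_sum (f := fun i => ∑ j ∈ A, |x i - x j|)
          (fun _ _ => Finset.sum_nonneg fun _ _ => abs_nonneg _) ha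
    _ ≤ spread Δ x :=
        Finset.single_le_sum (f := fun A => ∑ i ∈ A, ∑ j ∈ A, |x i - x j|)
          (fun _ _ => Finset.sum_nonneg fun _ _ => Finset.sum_nonneg fun _ _ => abs_nonneg _) hA

lemma measurable_spread {ι : Type*} (Δ : Finset (Finset ι)) : Measurable (spread Δ) := by
  unfold spread
  fun_prop

/-- Completing a family of pairs taken from a pairing by singletons to a partition. -/
lemma IsPartitionOf.completion {B : Finset α} {p W : Finset (Finset α)} (hp : IsPartitionOf B p)
    (hW : W ⊆ p) : IsPartitionOf B (W ∪ (B \ W.sup id).image fun a => {a}) := by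
  have hmem : ∀ D ∈ W ∪ (B \ W.sup id).image (fun a => ({a} : Finset α)),
      D ∈ W ∨ ∃ a ∈ B, a ∉ W.sup id ∧ D = {a} := by
    intro D hD
    rcases Finset.mem_union.1 hD with h | h
    · exact Or.inl h
    · obtain ⟨a, ha, rfl⟩ := Finset.mem_image.1 h
      rw [Finset.mem_sdiff] at ha
      exact Or.inr ⟨a, ha.1, ha.2, rfl⟩
  refine ⟨fun D hD => ?_, ?_, fun D hD A hA hne => ?_⟩
  · rcases hmem D hD with h | ⟨a, -, -, rfl⟩
    · exact hp.1 D (hW h)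
    · exact Finset.singleton_nonempty a
  · apply le_antisymm
    · refine Finset.sup_le fun D hD => ?_
      rcases hmem D hD with h | ⟨a, ha, -, rfl⟩
      · exact hp.subset (hW h)
      · simpa using ha
    · intro a ha
      by_cases h : a ∈ W.sup id
      · have hsub : W.sup id ⊆ (W ∪ (B \ W.sup id).image fun a => {a}).sup id :=
          Finset.sup_mono Finset.subset_union_left
        exact hsub h
      · exact Finset.mem_sup.2 ⟨{a}, Finset.mem_union_right _
          (Finset.mem_image.2 ⟨a, Finset.mem_sdiff.2 ⟨ha, h⟩, rfl⟩), by simp⟩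
  · rcases hmem D hD with h | ⟨a, -, ha, rfl⟩ <;> rcases hmem A hA with h' | ⟨b, -, hb, rfl⟩
    · exact hp.2.2 D (hW h) A (hW h') hne
    · rw [Finset.disjoint_singleton_right]
      exact fun hbD => hb (Finset.mem_sup.2 ⟨D, h, hbD⟩)
    · rw [Finset.disjoint_singleton_left]
      exact fun haA => ha (Finset.mem_sup.2 ⟨A, h', haA⟩)
    · rw [Finset.disjoint_singleton]
      rintro rfl
      exact hne rfl

lemma lmarginal_exp_spread_le {β c : ℝ} (hβ : -1 < β) (hβ' : β < 0) (hc : 0 < c)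
    {B : Finset α} (hB : B.Nonempty) {Δ p F G : Finset (Finset α)} (hΔ : IsPartitionOf B Δ)
    (hp : IsPartitionOf B p) (hpair : ∀ b ∈ p, b.card = 2) (hF : F ⊆ p) (hG : G ⊆ p)
    (hFG : Disjoint F G) (hconn : ConnectedPair B Δ F) :
    ∃ C : ENNReal, C ≠ ⊤ ∧ ∀ S T : ℝ, S < T → ∀ x,
      (lmarginal (fun _ : α => volume.restrict (Set.Icc S T)) B fun x =>
        ENNReal.ofReal (Real.exp (-c * spread Δ x)) *
          ((∏ q ∈ F, ENNReal.ofReal (|pairGap x q| ^ β)) *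
            ∏ q ∈ G, truncKernel β 1 (pairGap x q))) x ≤
        C * ENNReal.ofReal ((T - S) * ((T - S) ^ (β + 1)) ^ F.card) := by
  set P : Finset (Finset α) :=
    (F ∪ G) ∪ (B \ (F ∪ G).sup id).image (fun a => ({a} : Finset α)) with hP_def
  have hFGp : F ∪ G ⊆ p := Finset.union_subset hF hG
  have hP : IsPartitionOf B P := hp.completion hFGp
  have hWP : F ∪ G ⊆ P := Finset.subset_union_left
  have hcP : ConnectedPair B P Δ := fun S hS h1 h2 =>
    hconn S hS h2 fun b hb => h1 b (hWP (Finset.mem_union_left _ hb))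
  have hne : P.Nonempty := by
    rw [Finset.nonempty_iff_ne_empty]
    intro h
    have := hP.2.1
    rw [h, Finset.sup_empty] at this
    exact hB.ne_empty this.symm
  have hPW : ∀ D ∈ P, D ∉ F ∪ G → D.card = 1 := by
    intro D hD hDW
    obtain ⟨a, -, rfl⟩ := Finset.mem_image.1 ((Finset.mem_union.1 hD).resolve_left hDW)
    exact Finset.card_singleton a
  have hN : (0 : ℝ) < P.card := by exact_mod_cast Finset.card_pos.2 hne
  set c' : ℝ := c / P.card with hc'_def
  have hc' : 0 < c' := by positivity
  set h : ℝ → ENNReal := fun u => ENNReal.ofReal (Real.exp (-c' * |u|)) with hh_def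
  have hh : Measurable h := by fun_prop
  set M : ENNReal := ∫⁻ u, h u with hM_def
  have hMtop : M ≠ ⊤ := lintegral_exp_neg_mul_abs_ne_top hc'
  set K₁ := ENNReal.ofReal (1 + 2 / (β + 1))
  set K₂ := ENNReal.ofReal (2 / (β + 1) * 1 ^ (β + 1))
  refine ⟨M ^ (P.card - 1) * (K₁ ^ F.card * K₂ ^ G.card), by finiteness, fun S T hST x => ?_⟩
  have hL : 0 < T - S := sub_pos.2 hST
  set κ : Finset α → ℝ → ENNReal := fun D u =>
    if D ∈ F then ENNReal.ofReal (|u| ^ β) else truncKernel β 1 u with hκ_def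
  have hprod : ∀ (f g : Finset α → ENNReal),
      ∏ D ∈ F ∪ G, (if D ∈ F then f D else g D) = (∏ D ∈ F, f D) * ∏ D ∈ G, g D := by
    intro f g
    rw [Finset.prod_union hFG]
    congr 1
    · exact Finset.prod_congr rfl fun D hD => if_pos hD
    · exact Finset.prod_congr rfl fun D hD => if_neg fun h => Finset.disjoint_left.1 hFG h hD
  have key := lmarginal_pairs_le (volume.restrict (Set.Icc S T)) hP
    (fun A hA => hΔ.subset hA) hcP hne hWP (fun D hD => hpair D (hFGp hD)) hPW
    (κ := κ) ?_ (ψ := fun x => ENNReal.ofReal (Real.exp (-c' * spread Δ x))) hh ?_ (M := M)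
    (K := fun D => if D ∈ F then K₁ * ENNReal.ofReal ((T - S) ^ (β + 1)) else K₂) ?_ ?_ x
  · refine (lmarginal_mono (fun y => ?_) x).trans (key.trans (le_of_eq ?_))
    · refine mul_le_mul' ?_ (hprod _ _).ge
      rw [← ENNReal.ofReal_pow (Real.exp_nonneg _), ← Real.exp_nat_mul]
      refine ENNReal.ofReal_le_ofReal (Real.exp_le_exp.2 ?_)
      have h1 : ((P.card - 1 : ℕ) : ℝ) * c' ≤ c := by
        have : ((P.card - 1 : ℕ) : ℝ) ≤ P.card := by exact_mod_cast Nat.sub_le _ _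
        calc _ ≤ (P.card : ℝ) * c' := by gcongr
          _ = c := by rw [hc'_def]; field_simp
      nlinarith [mul_le_mul_of_nonneg_right h1 (spread_nonneg Δ y)]
    · rw [hprod, Finset.prod_const, Finset.prod_const, Measure.restrict_apply_univ,
        Real.volume_Icc, ENNReal.ofReal_mul hL.le, ENNReal.ofReal_pow (by positivity)]
      ring
  · intro D
    by_cases hD : D ∈ F
    · simp only [hκ_def, hD, if_true]
      fun_prop
    · simp only [hκ_def, hD, if_false]
      exact measurable_truncKernel β 1
  · intro A hA a ha b hb x
    refine ENNReal.ofReal_le_ofReal (Real.exp_le_exp.2 ?_)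
    nlinarith [abs_sub_le_spread hA ha hb x]
  · intro D u
    by_cases hD : D ∈ F
    · simp only [hκ_def, hD, if_true, abs_abs]
      exact lintegral_rpow_abs_sub_le hβ hβ' hST u
    · simp only [hκ_def, hD, if_false]
      have : ∀ v, truncKernel β 1 |v| = truncKernel β 1 v := by simp [truncKernel]
      simp only [this]
      exact lintegral_truncKernel_sub_le hβ hβ'.ne zero_le_one _ Measure.restrict_le_self u
  · intro u
    refine (lintegral_mono' Measure.restrict_le_self le_rfl).trans (le_of_eq ?_)
    exact lintegral_sub_left_eq_self h u

/-- The lower integral bound behind `stmt3`, with the power of the side length made explicit. -/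
lemma exists_lintegral_bound {β c : ℝ} (hβ : -1 < β) (hβ' : β < 0) (hc : 0 < c)
    {B : Finset α} (hB : B.Nonempty) {Δ p : Finset (Finset α)} (hΔ : IsPartitionOf B Δ)
    (hp : IsPartitionOf B p) (hpair : ∀ b ∈ p, b.card = 2) (hconn : ConnectedPair B Δ p) :
    ∃ k : ℕ, k + 1 ≤ Δ.card ∧ ∃ C : ENNReal, C ≠ ⊤ ∧ ∀ S T : ℝ, S < T →
      ∫⁻ r : {x // x ∈ B} → ℝ in Set.univ.pi fun _ => Set.Icc S T,
        ENNReal.ofReal (Real.exp (-c * spread Δ (extendBy B r)) *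
          ∏ q ∈ p, pairGap (extendBy B r) q ^ β) ≤
        C * ENNReal.ofReal ((T - S) * ((T - S) ^ (β + 1)) ^ k) := by
  have hΔne : Δ.Nonempty := by
    rw [Finset.nonempty_iff_ne_empty]
    rintro rfl
    exact hB.ne_empty (by simpa using hΔ.2.1.symm)
  obtain ⟨F, hF, hFk, hconnF⟩ :=
    hconn.exists_small_subfamily hΔ (fun A hA => hp.subset hA) hΔne
  have hGp : ∀ G ∈ (p \ F).powerset, G ⊆ p := fun G hG =>
    (Finset.mem_powerset.1 hG).trans Finset.sdiff_subset
  have hex : ∀ G ∈ (p \ F).powerset, ∃ C : ENNReal, C ≠ ⊤ ∧ ∀ S T : ℝ, S < T → ∀ x,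
      (lmarginal (fun _ : α => volume.restrict (Set.Icc S T)) B fun x =>
        ENNReal.ofReal (Real.exp (-c * spread Δ x)) *
          ((∏ q ∈ F, ENNReal.ofReal (|pairGap x q| ^ β)) *
            ∏ q ∈ G, truncKernel β 1 (pairGap x q))) x ≤
        C * ENNReal.ofReal ((T - S) * ((T - S) ^ (β + 1)) ^ F.card) := fun G hG =>
    lmarginal_exp_spread_le hβ hβ' hc hB hΔ hp hpair hF (hGp G hG)
      (Finset.disjoint_sdiff.mono_right (Finset.mem_powerset.1 hG)) hconnF
  choose! C hCtop hC using hex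
  refine ⟨F.card, hFk, ∑ G ∈ (p \ F).powerset, C G, ENNReal.sum_ne_top.2 hCtop,
    fun S T hST => ?_⟩
  set f : Finset (Finset α) → (α → ℝ) → ENNReal := fun G x =>
    ENNReal.ofReal (Real.exp (-c * spread Δ x)) *
      ((∏ q ∈ F, ENNReal.ofReal (|pairGap x q| ^ β)) *
        ∏ q ∈ G, truncKernel β 1 (pairGap x q)) with hf_def
  have hf : ∀ G ∈ (p \ F).powerset, Measurable (f G) := by
    intro G hG
    have h1 : Measurable fun x : α → ℝ => ENNReal.ofReal (Real.exp (-c * spread Δ x)) := by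
      have := measurable_spread Δ
      fun_prop
    refine h1.mul (Measurable.mul ?_ ?_)
    · refine Finset.measurable_fun_prod _ fun q hq => ?_
      have := measurable_pairGap (hpair q (hF hq))
      fun_prop
    · exact Finset.measurable_fun_prod _ fun q hq =>
        (measurable_truncKernel β 1).comp (measurable_pairGap (hpair q (hGp G hG hq)))
  have hpt : ∀ x : α → ℝ, ENNReal.ofReal (Real.exp (-c * spread Δ x) * ∏ q ∈ p, pairGap x q ^ β) ≤
      ∑ G ∈ (p \ F).powerset, f G x := by
    intro x
    simp only [hf_def]
    rw [ENNReal.ofReal_mul (Real.exp_nonneg _), ← Finset.mul_sum, ← Finset.mul_sum,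
      ENNReal.ofReal_prod_of_nonneg fun q hq => Real.rpow_nonneg (pairGap_nonneg x (hpair q hq)) _,
      ← Finset.prod_one_add, ← Finset.prod_sdiff hF, mul_comm (∏ q ∈ p \ F, _)]
    refine mul_le_mul' le_rfl (mul_le_mul' (Finset.prod_le_prod' fun q hq => ?_)
      (Finset.prod_le_prod' fun q hq => ?_))
    · rw [abs_of_nonneg (pairGap_nonneg x (hpair q (hF hq)))]
    · have := ofReal_rpow_le_add_truncKernel hβ'.le one_pos (pairGap x q)
      rwa [abs_of_nonneg (pairGap_nonneg x (hpair q (Finset.sdiff_subset hq))), Real.one_rpow,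
        ENNReal.ofReal_one] at this
  have hext : ∀ r : {x // x ∈ B} → ℝ,
      extendBy B r = Function.updateFinset (fun _ => 0) B r := fun r => rfl
  rw [volume_pi, Measure.restrict_pi_pi]
  calc _ ≤ ∫⁻ r : {x // x ∈ B} → ℝ, ∑ G ∈ (p \ F).powerset, f G (extendBy B r)
        ∂Measure.pi fun _ => volume.restrict (Set.Icc S T) := lintegral_mono fun r => hpt _
    _ = ∑ G ∈ (p \ F).powerset,
        lmarginal (fun _ : α => volume.restrict (Set.Icc S T)) B (f G) (fun _ => 0) := by
      rw [lintegral_finsetSum]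
      · rfl
      · intro G hG
        simp only [hext]
        exact (hf G hG).comp measurable_updateFinset
    _ ≤ ∑ G ∈ (p \ F).powerset,
        C G * ENNReal.ofReal ((T - S) * ((T - S) ^ (β + 1)) ^ F.card) :=
      Finset.sum_le_sum fun G hG => hC G hG S T hST _
    _ = _ := by rw [Finset.sum_mul]

theorem stmt3 (H c s t : ℝ) (hH : H ∈ Set.Ioo (1 / 2 : ℝ) 1) (hc : 0 < c) (hst : s < t)
    (B : Finset α) (hB : 2 < B.card)
    (Δ p : Finset (Finset α))
    (hΔ : IsPartitionOf B Δ) (hΔsing : ∀ b ∈ Δ, b.card ≠ 1)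
    (hp : IsPartitionOf B p) (hpair : ∀ b ∈ p, b.card = 2)
    (hconn : ConnectedPair B Δ p) :
    ∃ C : ℝ, ∀ ε ∈ Set.Ioc (0 : ℝ) 1,
      Jtilde H c s t ε B Δ p ≤ C * ε ^ (2 - 2 * H) := by
  obtain ⟨hH1, hH2⟩ := hH
  have hΔ2 : ∀ A ∈ Δ, 2 ≤ A.card := fun A hA => by
    have h1 := Finset.card_pos.2 (hΔ.1 A hA)
    have h2 := hΔsing A hA
    omega
  have hcardΔ : 2 * Δ.card ≤ B.card := by
    rw [← hΔ.sum_card, mul_comm, ← smul_eq_mul]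
    exact Finset.card_nsmul_le_sum _ _ _ hΔ2
  have hcardp : B.card = 2 * p.card := by
    rw [← hp.sum_card, Finset.sum_congr rfl hpair, Finset.sum_const, smul_eq_mul, mul_comm]
  obtain ⟨k, hk, C, hCtop, hC⟩ := exists_lintegral_bound (β := 2 * H - 2) (by linarith)
    (by linarith) hc (Finset.card_pos.1 (by omega)) hΔ hp hpair hconn
  have hL : 0 < t - s := sub_pos.2 hst
  set D : ℝ := (t - s) * ((t - s) ^ (2 * H - 2 + 1)) ^ k with hD_def
  have hD : 0 ≤ D := by positivity
  refine ⟨C.toReal * D, fun ε hε => ?_⟩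
  obtain ⟨hε0, hε1⟩ := hε
  unfold Jtilde
  have e1 : (Δ.filter fun A => A.card = 1) = ∅ :=
    Finset.filter_eq_empty_iff.2 fun A hA => hΔsing A hA
  have e2 : (Δ.filter fun A => 2 ≤ A.card) = Δ := Finset.filter_true_of_mem hΔ2
  have e3 : ∀ x : α → ℝ, ∏ A ∈ Δ, Real.exp (-c * ∑ i ∈ A, ∑ j ∈ A, |x i - x j|) =
      Real.exp (-c * spread Δ x) := fun x => by
    rw [← Real.exp_sum, ← Finset.mul_sum, spread]
  rw [e1, e2, Finset.card_empty, Nat.cast_zero, zero_mul, zero_add]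
  simp only [e3]
  have hST : s / ε < t / ε := div_lt_div_of_pos_right hst hε0
  have hscale : (t / ε - s / ε) * ((t / ε - s / ε) ^ (2 * H - 2 + 1)) ^ k =
      D * ε ^ (-1 - (2 * H - 1) * k) := by
    rw [← sub_div, hD_def, Real.div_rpow hL.le hε0.le, div_pow, Real.rpow_sub hε0,
      Real.rpow_mul hε0.le, Real.rpow_natCast, Real.rpow_neg_one]
    rw [show (2 * H - 2 + 1) = 2 * H - 1 by ring]
    field_simp
  have hbound := hC _ _ hST
  rw [hscale] at hbound
  have hint : ∫ r : {x // x ∈ B} → ℝ in Set.univ.pi fun _ => Set.Icc (s / ε) (t / ε),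
      Real.exp (-c * spread Δ (extendBy B r)) *
        ∏ q ∈ p, pairGap (extendBy B r) q ^ (2 * H - 2) ≤
      C.toReal * (D * ε ^ (-1 - (2 * H - 1) * k)) := by
    refine (Real.le_norm_self _).trans ((norm_integral_le_lintegral_norm _).trans ?_)
    refine ENNReal.toReal_le_of_le_ofReal (by positivity) ?_
    rw [ENNReal.ofReal_mul ENNReal.toReal_nonneg, ENNReal.ofReal_toReal hCtop]
    refine le_trans (le_of_eq (lintegral_congr fun r => ?_)) hbound
    rw [Real.norm_of_nonneg]
    exact mul_nonneg (Real.exp_nonneg _) (Finset.prod_nonneg fun q hq =>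
      Real.rpow_nonneg (pairGap_nonneg _ (hpair q hq)) _)
  have hexp : 2 - 2 * H ≤ (B.card : ℝ) / 2 + (-1 - (2 * H - 1) * k) := by
    have h1 : (k : ℝ) + 1 ≤ p.card := by
      exact_mod_cast (by omega : k + 1 ≤ p.card)
    have h2 : (2 : ℝ) ≤ p.card := by
      exact_mod_cast (by omega : 2 ≤ p.card)
    have h3 : (B.card : ℝ) / 2 = p.card := by
      rw [hcardp]
      push_cast
      ring
    rw [h3]
    nlinarith
  calc ε ^ ((B.card : ℝ) / 2) * _
      ≤ ε ^ ((B.card : ℝ) / 2) * (C.toReal * (D * ε ^ (-1 - (2 * H - 1) * k))) :=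
        mul_le_mul_of_nonneg_left hint (by positivity)
    _ = C.toReal * D * ε ^ ((B.card : ℝ) / 2 + (-1 - (2 * H - 1) * k)) := by
        rw [Real.rpow_add hε0]
        ring
    _ ≤ C.toReal * D * ε ^ (2 - 2 * H) :=
        mul_le_mul_of_nonneg_left (Real.rpow_le_rpow_of_exponent_ge hε0 hε1 hexp) (by positivity)
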